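/- For n ≥ 2, the cardinality of the family 𝒜_n satisfies log₂|𝒜_n| ≥ n·log₂(9) − Θ(log n) ≥ 3.16n − Θ(log n). -/

import Mathlib

/-- `π` is (the extension by junk of) a Baxter permutation of `{1,…,m}`:
a bijection of `{1,…,m}` avoiding the patterns 2-41-3 and 3-14-2. -/
def IsBaxterPerm (m : ℕ) (π : ℕ → ℕ) : Prop :=
  Set.BijOn π (Set.Icc 1 m) (Set.Icc 1 m) ∧
  (¬ ∃ p q r, 1 ≤ p ∧ p < q ∧ q + 1 < r ∧ r ≤ m ∧
      π (q + 1) < π p ∧ π p < π r ∧ π r < π q) ∧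
  (¬ ∃ p q r, 1 ≤ p ∧ p < q ∧ q + 1 < r ∧ r ≤ m ∧
      π q < π r ∧ π r < π p ∧ π p < π (q + 1))

/-- Membership in the family `𝒜ₙ`: some `k` positions in `{2,…,n}` copy the value of their
left neighbour, and the remaining `n-k` positions carry a Baxter permutation in order. -/
def InFamilyA (n : ℕ) (A : ℕ → ℕ) : Prop :=
  ∃ K : Finset ℕ, K ⊆ Finset.Icc 2 n ∧
    ∃ π : ℕ → ℕ, IsBaxterPerm (n - K.card) π ∧
      (∀ i, 2 ≤ i → i ≤ n → i ∈ K → A i = A (i - 1)) ∧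
      (∀ i, 1 ≤ i → i ≤ n → i ∉ K →
        A i = π (((Finset.Icc 1 i).filter (fun t => t ∉ K)).card))

/-- The family `𝒜ₙ`, with arrays normalized to be `0` outside `{1,…,n}`. -/
def famA (n : ℕ) : Set (ℕ → ℕ) :=
  {A | InFamilyA n A ∧ ∀ i, i = 0 ∨ n < i → A i = 0}

/-! ### Binomial coefficients with an integer lower index -/

/-- The binomial coefficient `n choose k`, extended by zero to negative `k`. -/
def intChoose (n : ℕ) (k : ℤ) : ℤ := if k < 0 then 0 else (n.choose k.toNat : ℤ)

theorem intChoose_natCast (n k : ℕ) : intChoose n k = n.choose k := by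
  simp [intChoose]

theorem intChoose_succ (n : ℕ) (k : ℤ) :
    intChoose (n + 1) k = intChoose n k + intChoose n (k - 1) := by
  rcases lt_trichotomy k 0 with h | rfl | h
  · simp [intChoose, h, show k < 1 by omega]
  · simp [intChoose]
  · obtain ⟨l, rfl⟩ : ∃ l : ℕ, k = (l + 1 : ℕ) := ⟨(k - 1).toNat, by omega⟩
    have h2 : ((l + 1 : ℕ) : ℤ) - 1 = (l : ℕ) := by push_cast; ring
    rw [h2, intChoose_natCast, intChoose_natCast, intChoose_natCast, Nat.choose_succ_succ]
    push_cast; ring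

theorem intChoose_symm (n : ℕ) (k : ℤ) : intChoose n (n - k) = intChoose n k := by
  by_cases h : k < 0
  · have h1 : ¬ ((n : ℤ) - k < 0) := by omega
    simp only [intChoose, h, h1, if_true, if_false]
    exact_mod_cast Nat.choose_eq_zero_of_lt (by omega)
  · obtain ⟨l, rfl⟩ : ∃ l : ℕ, k = l := ⟨k.toNat, by omega⟩
    rcases lt_or_ge n l with h2 | h2
    · rw [intChoose_natCast, Nat.choose_eq_zero_of_lt h2]
      simp [intChoose, show (n : ℤ) < l by exact_mod_cast h2]
    · rw [← Nat.cast_sub h2, intChoose_natCast, intChoose_natCast, Nat.choose_symm h2]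

theorem sum_intChoose (n i : ℕ) (k : ℤ) :
    ∑ a ∈ Finset.range (i + 1), intChoose (n + a) k =
      intChoose (n + i + 1) (k + 1) - intChoose n (k + 1) := by
  induction i with
  | zero => simp [intChoose_succ n (k + 1)]
  | succ i ih =>
    rw [Finset.sum_range_succ, ih, ← add_assoc, intChoose_succ (n + i + 1) (k + 1)]
    simp; ring

/-! ### Counting paths in the generating tree of Baxter permutations -/

/-- The number of nodes at depth `n` below a node labelled `(i, j)` in the generating tree of
Baxter permutations, whose succession rule is
`(i, j) ⟶ (1, j + 1), …, (i, j + 1), (i + 1, 1), …, (i + 1, j)`. -/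
def treeCount : ℕ → ℕ → ℕ → ℕ
  | 0, _, _ => 1
  | n + 1, i, j => ∑ a ∈ Finset.range i, treeCount n (a + 1) (j + 1) +
      ∑ b ∈ Finset.range j, treeCount n (i + 1) (b + 1)

/-- A summand of the determinant `treeDet`. -/
def treeTerm (n : ℕ) (p : ℤ) (i j : ℕ) (x y z : ℤ) : ℤ :=
  intChoose n (p + y) * intChoose (n + i) (n - p - 1 - x) * intChoose (n + j) (p + z - 1)

/-- The determinant counting the paths of length `n` from the label `(i + 1, j + 1)` in the
generating tree that use `p` steps of the second kind. -/
def treeDet (n : ℕ) (p : ℤ) (i j : ℕ) : ℤ :=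
  treeTerm n p i j (-1) 0 1 - treeTerm n p i j 0 (-1) 1 + treeTerm n p i j 0 1 (-1)
    - treeTerm n p i j (-1) 1 0 + treeTerm n p i j 1 (-1) 0 - treeTerm n p i j 1 0 (-1)

theorem treeTerm_succ (n : ℕ) (p : ℤ) (i j : ℕ) (x y z : ℤ) :
    treeTerm (n + 1) p i j x y z =
      ∑ a ∈ Finset.range (i + 1), treeTerm n p a (j + 1) x y z +
      ∑ b ∈ Finset.range (j + 1), treeTerm n (p - 1) (i + 1) b x y z +
      (intChoose n (p + y) * intChoose n (p + x) * intChoose (n + j + 1) (p + z - 1) +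
       intChoose n (p + (y - 1)) * intChoose n (p + (z - 1)) *
          intChoose (n + i + 1) (n - p - x)) := by
  have h1 : ∑ a ∈ Finset.range (i + 1), treeTerm n p a (j + 1) x y z =
      intChoose n (p + y) * (intChoose (n + i + 1) (n - p - x) - intChoose n (p + x)) *
        intChoose (n + j + 1) (p + z - 1) := by
    simp only [treeTerm, ← Finset.sum_mul, ← Finset.mul_sum, sum_intChoose]
    rw [show (n : ℤ) - p - 1 - x + 1 = n - (p + x) by ring, intChoose_symm,
      show (n : ℤ) - (p + x) = n - p - x by ring]
    rfl
  have h2 : ∑ b ∈ Finset.range (j + 1), treeTerm n (p - 1) (i + 1) b x y z =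
      intChoose n (p + (y - 1)) * intChoose (n + i + 1) (n - p - x) *
        (intChoose (n + j + 1) (p + z - 1) - intChoose n (p + (z - 1))) := by
    simp only [treeTerm, ← Finset.mul_sum, sum_intChoose]
    rw [show (n : ℤ) - (p - 1) - 1 - x = n - p - x by ring,
      show p - 1 + z - 1 + 1 = p + z - 1 by ring, show p - 1 + y = p + (y - 1) by ring,
      show p + (z - 1) = p + z - 1 by ring]
    rfl
  rw [h1, h2, treeTerm, intChoose_succ n (p + y), show p + y - 1 = p + (y - 1) by ring,
    show n + 1 + i = n + i + 1 by ring, show n + 1 + j = n + j + 1 by ring,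
    show ((n + 1 : ℕ) : ℤ) - p - 1 - x = n - p - x by push_cast; ring]
  ring

theorem treeDet_succ (n : ℕ) (p : ℤ) (i j : ℕ) :
    treeDet (n + 1) p i j = ∑ a ∈ Finset.range (i + 1), treeDet n p a (j + 1) +
      ∑ b ∈ Finset.range (j + 1), treeDet n (p - 1) (i + 1) b := by
  simp only [treeDet, Finset.sum_add_distrib, Finset.sum_sub_distrib, treeTerm_succ]
  norm_num
  ring

theorem treeDet_zero (p : ℤ) (i j : ℕ) : treeDet 0 p i j = if p = 0 then 1 else 0 := by
  have h (k : ℤ) (hk : k ≠ 0) : intChoose 0 k = 0 := by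
    rcases lt_or_gt_of_ne hk with h | h
    · simp [intChoose, h]
    · rw [intChoose, if_neg (by omega), Nat.choose_eq_zero_of_lt (by omega)]; rfl
  have hneg (n : ℕ) (k : ℤ) (hk : k < 0) : intChoose n k = 0 := by simp [intChoose, hk]
  by_cases h0 : p = 0
  · subst h0
    simp [treeDet, treeTerm, intChoose]
  · rw [if_neg h0]
    rcases lt_or_gt_of_ne h0 with h1 | h1
    · simp only [treeDet, treeTerm, zero_add]
      rw [hneg j (p + 1 - 1) (by omega), hneg j (p + -1 - 1) (by omega),
        hneg j (p + 0 - 1) (by omega)]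
      ring
    · simp only [treeDet, treeTerm, zero_add]
      rw [hneg i _ (by push_cast; omega), hneg i _ (by push_cast; omega),
        hneg i _ (by push_cast; omega)]
      ring

theorem sum_treeDet_le_treeCount (n : ℕ) (P : Finset ℤ) (i j : ℕ) :
    ∑ p ∈ P, treeDet n p i j ≤ treeCount n (i + 1) (j + 1) := by
  induction n generalizing P i j with
  | zero =>
    simp only [treeDet_zero, treeCount, Finset.sum_ite_eq']
    split_ifs <;> simp
  | succ n ih =>
    simp only [treeDet_succ, treeCount, Finset.sum_add_distrib]
    push_cast
    rw [Finset.sum_comm, Finset.sum_comm (s := P)]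
    refine add_le_add (Finset.sum_le_sum fun a _ => ih P a (j + 1))
      (Finset.sum_le_sum fun b _ => ?_)
    rw [← Finset.sum_image (f := fun p => treeDet n p (i + 1) b) (g := fun p => p - 1)
      (fun x _ y _ h => by simpa using h)]
    exact ih _ (i + 1) b

theorem treeDet_central (p : ℕ) :
    ((p : ℤ) + 1) ^ 3 * (p + 2) ^ 2 * treeDet (2 * p) p 0 0 =
      (p.centralBinom : ℤ) ^ 3 * (4 * p + 2) ^ 2 := by
  have hs1 : intChoose (2 * p) (p - 1) = intChoose (2 * p) (p + 1) := by
    rw [← intChoose_symm]; congr 1; push_cast; ring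
  have hs2 : intChoose (2 * p) (p - 2) = intChoose (2 * p) (p + 2) := by
    rw [← intChoose_symm]; congr 1; push_cast; ring
  have h0 : intChoose (2 * p) p = p.centralBinom := by
    rw [intChoose_natCast, Nat.centralBinom_eq_two_mul_choose]
  have h1 : ((p : ℤ) + 1) * intChoose (2 * p) (p + 1) = p * p.centralBinom := by
    have := Nat.choose_succ_right_eq (2 * p) p
    rw [show (p : ℤ) + 1 = (p + 1 : ℕ) by push_cast; ring, intChoose_natCast,
      Nat.centralBinom_eq_two_mul_choose]
    rw [show 2 * p - p = p by omega] at this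
    push_cast; zify at this; linarith
  have h2 : ((p : ℤ) + 2) * intChoose (2 * p) (p + 2) =
      (p - 1) * intChoose (2 * p) (p + 1) := by
    have := Nat.choose_succ_right_eq (2 * p) (p + 1)
    rw [show (p : ℤ) + 2 = (p + 2 : ℕ) by push_cast; ring,
      show (p : ℤ) + 1 = (p + 1 : ℕ) by push_cast; ring, intChoose_natCast, intChoose_natCast]
    rcases p with _ | p
    · simp [Nat.choose]
    · rw [show 2 * (p + 1) - (p + 1 + 1) = p by omega] at this
      push_cast; zify at this; linarith
  have hd : treeDet (2 * p) p 0 0 =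
      (p.centralBinom - intChoose (2 * p) (p + 2)) *
      (p.centralBinom ^ 2 + p.centralBinom * intChoose (2 * p) (p + 2)
        - 2 * intChoose (2 * p) (p + 1) ^ 2) := by
    simp only [treeDet, treeTerm]
    push_cast
    ring_nf
    rw [show (-2 : ℤ) + p = p - 2 by ring, show (-1 : ℤ) + p = p - 1 by ring,
      show (1 : ℤ) + p = p + 1 by ring, show (2 : ℤ) + p = p + 2 by ring] at *
    simp only [show p * 2 = 2 * p by ring, hs1, hs2, h0]
    ring
  rw [hd]
  generalize (p.centralBinom : ℤ) = c at *
  generalize intChoose (2 * p) (p + 1) = c1 at *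
  generalize intChoose (2 * p) (p + 2) = c2 at *
  have e1 : ((p : ℤ) + 1) * (p + 2) * (c - c2) = c * (4 * p + 2) := by
    linear_combination (-(p : ℤ) - 1) * h2 - ((p : ℤ) - 1) * h1
  have e2 : ((p : ℤ) + 1) ^ 2 * (p + 2) * (c ^ 2 + c * c2 - 2 * c1 ^ 2) =
      c ^ 2 * (4 * p + 2) := by
    linear_combination ((p : ℤ) + 1) ^ 2 * c * h2 + ((p : ℤ) + 1) * (p - 1) * c * h1
      - 2 * (p + 2) * ((p + 1) * c1 + p * c) * h1
  linear_combination (((p : ℤ) + 1) ^ 2 * (p + 2) * (c ^ 2 + c * c2 - 2 * c1 ^ 2)) * e1 +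
    c * (4 * p + 2) * e2

theorem pow_le_treeCount (p : ℕ) :
    8 ^ (2 * p + 1) ≤ 8 * (2 * p + 1) ^ 6 * treeCount (2 * p) 1 1 := by
  have h1 := sum_treeDet_le_treeCount (2 * p) {(p : ℤ)} 0 0
  rw [Finset.sum_singleton] at h1
  have h2 := treeDet_central p
  have h3 : (4 : ℤ) ^ p ≤ (2 * p + 1) * p.centralBinom := by
    exact_mod_cast Nat.four_pow_le_two_mul_add_one_mul_central_binom p
  have h4 : ((4 : ℤ) ^ p) ^ 3 ≤ ((2 * p + 1) * p.centralBinom) ^ 3 := by gcongr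
  zify
  have h5 : (8 : ℤ) ^ (2 * p + 1) = 8 * (4 ^ p) ^ 3 := by
    rw [← pow_mul, show (4 : ℤ) = 2 ^ 2 by norm_num, show (8 : ℤ) = 2 ^ 3 by norm_num,
      ← pow_mul, ← pow_mul, ← pow_add]
    congr 1; ring
  rw [h5]
  norm_num at h1
  generalize (treeCount (2 * p) 1 1 : ℤ) = v at *
  generalize treeDet (2 * p) p 0 0 = d at *
  have hd : 0 ≤ d := by
    have : 0 < ((p : ℤ) + 1) ^ 3 * (p + 2) ^ 2 := by positivity
    have h : 0 ≤ ((p : ℤ) + 1) ^ 3 * (p + 2) ^ 2 * d := by rw [h2]; positivity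
    exact nonneg_of_mul_nonneg_right h this
  have hp : (0 : ℤ) ≤ p := by positivity
  have h6 : 4 * (4 ^ p) ^ 3 ≤ (2 * (p : ℤ) + 1) * (((p : ℤ) + 1) ^ 3 * (p + 2) ^ 2 * d) := by
    rw [h2]
    calc _ ≤ 4 * ((2 * p + 1) * (p.centralBinom : ℤ)) ^ 3 := by gcongr
      _ = _ := by ring
  have h7 : (2 * (p : ℤ) + 1) * (((p : ℤ) + 1) ^ 3 * (p + 2) ^ 2 * d) ≤
      (2 * (p : ℤ) + 1) * ((2 * p + 1) ^ 3 * (2 * (2 * p + 1)) ^ 2 * v) := by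
    gcongr <;> linarith
  nlinarith [h6, h7]

/-! ### Sums over a finite set of ranks -/

theorem sum_card_filter_lt (S : Finset ℕ) (f : ℕ → ℕ) :
    ∑ s ∈ S, f (S.filter (· < s)).card = ∑ a ∈ Finset.range S.card, f a := by
  induction S using Finset.induction_on_max with
  | empty => simp
  | insert a S h ih =>
    have ha : a ∉ S := fun h' => (h a h').false
    rw [Finset.sum_insert ha, Finset.card_insert_of_notMem ha, Finset.sum_range_succ, ← ih,
      add_comm]
    congr 1
    · refine Finset.sum_congr rfl fun s hs => ?_
      rw [Finset.filter_insert, if_neg (by have := h s hs; omega)]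
    · rw [Finset.filter_insert, if_neg (by omega), Finset.filter_true_of_mem h]

theorem sum_card_filter_gt (S : Finset ℕ) (f : ℕ → ℕ) :
    ∑ s ∈ S, f (S.filter (s < ·)).card = ∑ a ∈ Finset.range S.card, f a := by
  induction S using Finset.induction_on_min with
  | empty => simp
  | insert a S h ih =>
    have ha : a ∉ S := fun h' => (h a h').false
    rw [Finset.sum_insert ha, Finset.card_insert_of_notMem ha, Finset.sum_range_succ, ← ih,
      add_comm]
    congr 1
    · refine Finset.sum_congr rfl fun s hs => ?_
      rw [Finset.filter_insert, if_neg (by have := h s hs; omega)]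
    · rw [Finset.filter_insert, if_neg (by omega), Finset.filter_true_of_mem h]

/-! ### The generating tree of Baxter permutations -/

theorem finite_setOf_bounded (n : ℕ) :
    {A : ℕ → ℕ | (∀ i, i = 0 ∨ n < i → A i = 0) ∧ ∀ i, A i ≤ n}.Finite := by
  refine Set.Finite.of_finite_image (f := fun A : ℕ → ℕ => fun i : Fin (n + 1) =>
    (Fin.ofNat (n + 1) (A i))) (Set.toFinite _) ?_
  rintro A ⟨hA, hA'⟩ B ⟨hB, hB'⟩ h
  funext i
  by_cases hi : n < i
  · rw [hA i (Or.inr hi), hB i (Or.inr hi)]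
  · have := congrArg Fin.val (congrFun h ⟨i, by omega⟩)
    simpa [Fin.ofNat, Nat.mod_eq_of_lt (Nat.lt_succ_of_le (hA' i)),
      Nat.mod_eq_of_lt (Nat.lt_succ_of_le (hB' i))] using this

/-- Baxter permutations of `{1,…,m}`, extended by zero. -/
def baxterSet (m : ℕ) : Set (ℕ → ℕ) :=
  {π | IsBaxterPerm m π ∧ ∀ i, i = 0 ∨ m < i → π i = 0}

theorem le_of_mem_baxterSet {m : ℕ} {π : ℕ → ℕ} (h : π ∈ baxterSet m) (i : ℕ) : π i ≤ m := by
  by_cases hi : i = 0 ∨ m < i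
  · simp [h.2 i hi]
  · exact (h.1.1.mapsTo (show i ∈ Set.Icc 1 m from ⟨by omega, by omega⟩)).2

theorem baxterSet_finite (m : ℕ) : (baxterSet m).Finite :=
  (finite_setOf_bounded m).subset fun _ h => ⟨h.2, le_of_mem_baxterSet h⟩

/-- The finite set of Baxter permutations of `{1,…,m}`, extended by zero. -/
noncomputable def baxterFinset (m : ℕ) : Finset (ℕ → ℕ) := (baxterSet_finite m).toFinset

theorem mem_baxterFinset {m : ℕ} {π : ℕ → ℕ} : π ∈ baxterFinset m ↔ π ∈ baxterSet m := by
  simp [baxterFinset]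

/-- Insert the value `m + 1` at position `s` of `π`. -/
def insertMax (m : ℕ) (π : ℕ → ℕ) (s i : ℕ) : ℕ :=
  if i < s then π i else if i = s then m + 1 else π (i - 1)

theorem insertMax_of_lt {m : ℕ} {π : ℕ → ℕ} {s i : ℕ} (h : i < s) : insertMax m π s i = π i := by
  simp [insertMax, h]

theorem insertMax_self (m : ℕ) (π : ℕ → ℕ) (s : ℕ) : insertMax m π s s = m + 1 := by
  simp [insertMax]

theorem insertMax_of_gt {m : ℕ} {π : ℕ → ℕ} {s i : ℕ} (h : s < i) :
    insertMax m π s i = π (i - 1) := by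
  simp [insertMax, show ¬ i < s by omega, show i ≠ s by omega]

open Classical in
/-- Positions of the left-to-right maxima of `π`. -/
noncomputable def lrMax (m : ℕ) (π : ℕ → ℕ) : Finset ℕ :=
  (Finset.Icc 1 m).filter fun s => ∀ t ∈ Finset.Ico 1 s, π t < π s

open Classical in
/-- Positions of the right-to-left maxima of `π`. -/
noncomputable def rlMax (m : ℕ) (π : ℕ → ℕ) : Finset ℕ :=
  (Finset.Icc 1 m).filter fun s => ∀ t ∈ Finset.Ioc s m, π t < π s

theorem mem_lrMax {m : ℕ} {π : ℕ → ℕ} {s : ℕ} :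
    s ∈ lrMax m π ↔ (1 ≤ s ∧ s ≤ m) ∧ ∀ t, 1 ≤ t → t < s → π t < π s := by
  simp [lrMax]

theorem mem_rlMax {m : ℕ} {π : ℕ → ℕ} {s : ℕ} :
    s ∈ rlMax m π ↔ (1 ≤ s ∧ s ≤ m) ∧ ∀ t, s < t → t ≤ m → π t < π s := by
  simp [rlMax]

theorem insertMax_injective {m s s' : ℕ} {π π' : ℕ → ℕ} (hπ' : π' ∈ baxterSet m)
    (h : insertMax m π s = insertMax m π' s') : π = π' ∧ s = s' := by
  have key {ρ : ℕ → ℕ} {u i : ℕ} (hρ : ρ ∈ baxterSet m) (hi : insertMax m ρ u i = m + 1) :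
      i = u := by
    rcases lt_trichotomy i u with h | h | h
    · have := le_of_mem_baxterSet hρ i
      rw [insertMax_of_lt h] at hi; omega
    · exact h
    · have := le_of_mem_baxterSet hρ (i - 1)
      rw [insertMax_of_gt h] at hi; omega
  have hs : s = s' := key hπ' (by rw [← h, insertMax_self])
  subst hs
  refine ⟨funext fun i => ?_, rfl⟩
  by_cases hi : i < s
  · rw [← insertMax_of_lt (m := m) (π := π) hi, h, insertMax_of_lt hi]
  · have := congrFun h (i + 1)
    rwa [insertMax_of_gt (by omega), insertMax_of_gt (by omega)] at this

theorem bijOn_insertMax {m s : ℕ} {π : ℕ → ℕ} (h1 : 1 ≤ s) (h2 : s ≤ m + 1)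
    (h : Set.BijOn π (Set.Icc 1 m) (Set.Icc 1 m)) :
    Set.BijOn (insertMax m π s) (Set.Icc 1 (m + 1)) (Set.Icc 1 (m + 1)) := by
  have hm : ∀ i, 1 ≤ i → i ≤ m → 1 ≤ π i ∧ π i ≤ m := fun i a b => h.mapsTo ⟨a, b⟩
  have hinj : ∀ i j, 1 ≤ i → i ≤ m → 1 ≤ j → j ≤ m → π i = π j → i = j :=
    fun i j a b c d e => h.injOn ⟨a, b⟩ ⟨c, d⟩ e
  refine ⟨?_, ?_, ?_⟩
  · rintro i ⟨hi1, hi2⟩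
    rcases lt_trichotomy i s with h' | rfl | h'
    · rw [insertMax_of_lt h']; have := hm i (by omega) (by omega); constructor <;> omega
    · rw [insertMax_self]; constructor <;> omega
    · rw [insertMax_of_gt h']; have := hm (i - 1) (by omega) (by omega); constructor <;> omega
  · rintro i ⟨hi1, hi2⟩ j ⟨hj1, hj2⟩ hij
    rcases lt_trichotomy i s with hi | hi | hi
    · have h3 := hm i hi1 (by omega)
      rw [insertMax_of_lt hi] at hij
      rcases lt_trichotomy j s with hj | hj | hj
      · rw [insertMax_of_lt hj] at hij
        exact hinj i j hi1 (by omega) hj1 (by omega) hij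
      · rw [hj, insertMax_self] at hij; omega
      · rw [insertMax_of_gt hj] at hij
        have := hinj i (j - 1) hi1 (by omega) (by omega) (by omega) hij
        omega
    · rw [hi, insertMax_self] at hij
      rcases lt_trichotomy j s with hj | hj | hj
      · have := hm j hj1 (by omega)
        rw [insertMax_of_lt hj] at hij; omega
      · omega
      · have := hm (j - 1) (by omega) (by omega)
        rw [insertMax_of_gt hj] at hij; omega
    · have h3 := hm (i - 1) (by omega) (by omega)
      rw [insertMax_of_gt hi] at hij
      rcases lt_trichotomy j s with hj | hj | hj
      · rw [insertMax_of_lt hj] at hij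
        have := hinj (i - 1) j (by omega) (by omega) hj1 (by omega) hij
        omega
      · rw [hj, insertMax_self] at hij; omega
      · rw [insertMax_of_gt hj] at hij
        have := hinj (i - 1) (j - 1) (by omega) (by omega) (by omega) (by omega) hij
        omega
  · rintro v ⟨hv1, hv2⟩
    rcases Nat.lt_or_ge m v with hv | hv
    · exact ⟨s, ⟨h1, h2⟩, by rw [insertMax_self]; omega⟩
    · obtain ⟨i, ⟨hi1, hi2⟩, rfl⟩ := h.surjOn (show v ∈ Set.Icc 1 m from ⟨hv1, hv⟩)
      by_cases hi : i < s
      · exact ⟨i, ⟨hi1, by omega⟩, insertMax_of_lt hi⟩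
      · exact ⟨i + 1, ⟨by omega, by omega⟩, by rw [insertMax_of_gt (by omega)]; rfl⟩

theorem insertMax_mem_baxterSet {m s : ℕ} {π : ℕ → ℕ} (hπ : π ∈ baxterSet m)
    (hs : s ∈ lrMax m π ∨ ∃ t ∈ rlMax m π, s = t + 1) :
    insertMax m π s ∈ baxterSet (m + 1) := by
  have hs1 : 1 ≤ s ∧ s ≤ m + 1 := by
    rcases hs with h | ⟨t, h, rfl⟩
    · have := (mem_lrMax.1 h).1; omega
    · have := (mem_rlMax.1 h).1; omega
  have hle := le_of_mem_baxterSet hπ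
  have hs2 : (∀ t, 1 ≤ t → t < s → s ≤ m ∧ π t < π s) ∨
      (∀ t, s ≤ t → t ≤ m → π t < π (s - 1)) := by
    rcases hs with h | ⟨t, h, rfl⟩
    · exact Or.inl fun t a b => ⟨(mem_lrMax.1 h).1.2, (mem_lrMax.1 h).2 t a b⟩
    · exact Or.inr fun u a b => (mem_rlMax.1 h).2 u a b
  obtain ⟨⟨hbij, hA, hB⟩, h0⟩ := hπ
  refine ⟨⟨bijOn_insertMax hs1.1 hs1.2 hbij, ?_, ?_⟩, ?_⟩
  · rintro ⟨p, q, r, hp, hpq, hqr, hr, e1, e2, e3⟩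
    push Not at hA
    by_cases hq : q = s
    · subst hq
      rw [insertMax_of_gt (by omega), insertMax_of_lt hpq] at e1
      rw [insertMax_of_gt (show q < r by omega), insertMax_of_lt hpq] at e2
      have := hA p (q - 1) (r - 1) hp
      grind
    · have h1 : insertMax m π s q ≤ m := by grind [insertMax]
      have hps : p ≠ s := by rintro rfl; rw [insertMax_self] at *; omega
      have hrs : r ≠ s := by rintro rfl; rw [insertMax_self] at *; omega
      have hqs : q + 1 ≠ s := by rintro rfl; rw [insertMax_self] at *; omega
      have := hA (if p < s then p else p - 1) (if q < s then q else q - 1)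
        (if r < s then r else r - 1)
      grind [insertMax]
  · rintro ⟨p, q, r, hp, hpq, hqr, hr, e1, e2, e3⟩
    push Not at hB
    by_cases hq : q + 1 = s
    · subst hq
      rw [insertMax_of_lt (by omega), insertMax_of_gt (by omega)] at e1
      rw [insertMax_of_gt (by omega), insertMax_of_lt (by omega)] at e2
      have := hB p q (r - 1) hp
      grind
    · have h1 : insertMax m π s (q + 1) ≤ m := by grind [insertMax]
      have hps : p ≠ s := by rintro rfl; rw [insertMax_self] at *; omega
      have hrs : r ≠ s := by rintro rfl; rw [insertMax_self] at *; omega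
      have hqs : q ≠ s := by rintro rfl; rw [insertMax_self] at *; omega
      have := hB (if p < s then p else p - 1) (if q < s then q else q - 1)
        (if r < s then r else r - 1)
      grind [insertMax]
  · intro i hi
    rcases lt_trichotomy i s with h' | h' | h'
    · rw [insertMax_of_lt h']; exact h0 _ (by omega)
    · omega
    · rw [insertMax_of_gt h']; exact h0 _ (by omega)

theorem exists_eq_max {m : ℕ} {π : ℕ → ℕ} (hπ : π ∈ baxterSet m) (hm : 1 ≤ m) :
    ∃ k, 1 ≤ k ∧ k ≤ m ∧ π k = m := by
  obtain ⟨k, hk, h⟩ := hπ.1.1.surjOn (show m ∈ Set.Icc 1 m from ⟨hm, le_rfl⟩)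
  exact ⟨k, hk.1, hk.2, h⟩

theorem le_of_mem_lrMax_of_mem_rlMax {m s t : ℕ} {π : ℕ → ℕ} (hπ : π ∈ baxterSet m)
    (hs : s ∈ lrMax m π) (ht : t ∈ rlMax m π) : s ≤ t := by
  have h1 := mem_lrMax.1 hs
  have h2 := mem_rlMax.1 ht
  obtain ⟨k, hk1, hk2, hk⟩ := exists_eq_max hπ (by omega)
  have ha : s ≤ k := by
    by_contra! h
    have := h1.2 k hk1 h
    have := le_of_mem_baxterSet hπ s
    omega
  have hb : k ≤ t := by
    by_contra! h
    have := h2.2 k h hk2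
    have := le_of_mem_baxterSet hπ t
    omega
  omega

theorem card_lrMax_insertMax_left {m s : ℕ} {π : ℕ → ℕ} (hπ : π ∈ baxterSet m)
    (hs : s ∈ lrMax m π) :
    (lrMax (m + 1) (insertMax m π s)).card = ((lrMax m π).filter (· < s)).card + 1 := by
  have hle := le_of_mem_baxterSet hπ
  rw [← Finset.card_insert_of_notMem (a := s) (by simp)]
  congr 1
  ext u
  have hs1 := (mem_lrMax.1 hs).1
  simp only [Finset.mem_insert, Finset.mem_filter, mem_lrMax]
  rcases lt_trichotomy u s with h | h | h
  · grind [insertMax]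
  · grind [insertMax]
  · have : ¬ ∀ t, 1 ≤ t → t < u → insertMax m π s t < insertMax m π s u := by
      intro h'
      have h2 := h' s hs1.1 h
      have h3 := hle (u - 1)
      rw [insertMax_self, insertMax_of_gt h] at h2; omega
    grind

theorem card_rlMax_insertMax_left {m s : ℕ} {π : ℕ → ℕ} (hπ : π ∈ baxterSet m)
    (hs : s ∈ lrMax m π) :
    (rlMax (m + 1) (insertMax m π s)).card = (rlMax m π).card + 1 := by
  have hle := le_of_mem_baxterSet hπ
  have hst : ∀ t ∈ rlMax m π, s ≤ t := fun t => le_of_mem_lrMax_of_mem_rlMax hπ hs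
  have hs1 := (mem_lrMax.1 hs).1
  rw [← Finset.card_image_of_injective (rlMax m π) (add_left_injective 1),
    ← Finset.card_insert_of_notMem (a := s) (by
      simp only [Finset.mem_image, not_exists, not_and]; intro t ht; have := hst t ht; omega)]
  congr 1
  ext u
  simp only [Finset.mem_insert, Finset.mem_image]
  rcases lt_trichotomy u s with h | h | h
  · have h1 : u ∉ rlMax (m + 1) (insertMax m π s) := by
      intro h'
      have h2 := (mem_rlMax.1 h').2 s h (by omega)
      have h3 := hle u
      rw [insertMax_self, insertMax_of_lt h] at h2; omega
    grind
  · subst h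
    simp only [true_or, iff_true, mem_rlMax]
    refine ⟨by omega, fun t h1 h2 => ?_⟩
    rw [insertMax_self, insertMax_of_gt h1]
    have := hle (t - 1); omega
  · obtain ⟨u, rfl⟩ : ∃ v, u = v + 1 := ⟨u - 1, by omega⟩
    have h1 : u + 1 ∈ rlMax (m + 1) (insertMax m π s) ↔ u ∈ rlMax m π := by
      simp only [mem_rlMax]
      constructor
      · rintro ⟨h1, h2⟩
        refine ⟨by omega, fun t h3 h4 => ?_⟩
        have := h2 (t + 1) (by omega) (by omega)
        rwa [insertMax_of_gt h, insertMax_of_gt (by omega)] at this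
      · rintro ⟨h1, h2⟩
        refine ⟨by omega, fun t h3 h4 => ?_⟩
        rw [insertMax_of_gt h, insertMax_of_gt (by omega)]
        exact h2 (t - 1) (by omega) (by omega)
    grind

theorem card_lrMax_insertMax_right {m s : ℕ} {π : ℕ → ℕ} (hπ : π ∈ baxterSet m)
    (hs : s ∈ rlMax m π) :
    (lrMax (m + 1) (insertMax m π (s + 1))).card = (lrMax m π).card + 1 := by
  have hle := le_of_mem_baxterSet hπ
  have hst : ∀ t ∈ lrMax m π, t ≤ s := fun t ht => le_of_mem_lrMax_of_mem_rlMax hπ ht hs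
  have hs1 := (mem_rlMax.1 hs).1
  rw [← Finset.card_insert_of_notMem (a := s + 1) (s := lrMax m π)
    (by intro ht; have := hst _ ht; omega)]
  congr 1
  ext u
  simp only [Finset.mem_insert]
  rcases lt_trichotomy u (s + 1) with h | h | h
  · have h1 : u ∈ lrMax (m + 1) (insertMax m π (s + 1)) ↔ u ∈ lrMax m π := by
      simp only [mem_lrMax]
      grind [insertMax]
    grind
  · subst h
    simp only [true_or, iff_true, mem_lrMax]
    refine ⟨by omega, fun t h1 h2 => ?_⟩
    rw [insertMax_self, insertMax_of_lt h2]
    have := hle t; omega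
  · have h1 : u ∉ lrMax (m + 1) (insertMax m π (s + 1)) := by
      intro h'
      have h2 := (mem_lrMax.1 h').2 (s + 1) (by omega) h
      have h3 := hle (u - 1)
      rw [insertMax_self, insertMax_of_gt h] at h2; omega
    grind

theorem card_rlMax_insertMax_right {m s : ℕ} {π : ℕ → ℕ} (hπ : π ∈ baxterSet m)
    (hs : s ∈ rlMax m π) :
    (rlMax (m + 1) (insertMax m π (s + 1))).card = ((rlMax m π).filter (s < ·)).card + 1 := by
  have hle := le_of_mem_baxterSet hπ
  have hs1 := (mem_rlMax.1 hs).1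
  rw [← Finset.card_image_of_injective ((rlMax m π).filter (s < ·)) (add_left_injective 1),
    ← Finset.card_insert_of_notMem (a := s + 1) (by simp)]
  congr 1
  ext u
  simp only [Finset.mem_insert, Finset.mem_image, Finset.mem_filter]
  rcases lt_trichotomy u (s + 1) with h | h | h
  · have h1 : u ∉ rlMax (m + 1) (insertMax m π (s + 1)) := by
      intro h'
      have h2 := (mem_rlMax.1 h').2 (s + 1) h (by omega)
      have h3 := hle u
      rw [insertMax_self, insertMax_of_lt h] at h2; omega
    grind
  · subst h
    simp only [true_or, iff_true, mem_rlMax]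
    refine ⟨by omega, fun t h1 h2 => ?_⟩
    rw [insertMax_self, insertMax_of_gt h1]
    have := hle (t - 1); omega
  · obtain ⟨u, rfl⟩ : ∃ v, u = v + 1 := ⟨u - 1, by omega⟩
    have h1 : u + 1 ∈ rlMax (m + 1) (insertMax m π (s + 1)) ↔ u ∈ rlMax m π := by
      simp only [mem_rlMax]
      constructor
      · rintro ⟨h1, h2⟩
        refine ⟨by omega, fun t h3 h4 => ?_⟩
        have := h2 (t + 1) (by omega) (by omega)
        rwa [insertMax_of_gt h, insertMax_of_gt (by omega)] at this
      · rintro ⟨h1, h2⟩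
        refine ⟨by omega, fun t h3 h4 => ?_⟩
        rw [insertMax_of_gt h, insertMax_of_gt (by omega)]
        exact h2 (t - 1) (by omega) (by omega)
    grind

/-- The sum of a function of the numbers of left-to-right and right-to-left maxima over all
Baxter permutations of size `m + 1` dominates the sum over the children, in the generating tree,
of the Baxter permutations of size `m`. -/
theorem sum_children_le (m : ℕ) (f : ℕ → ℕ → ℕ) :
    ∑ π ∈ baxterFinset m,
      (∑ a ∈ Finset.range (lrMax m π).card, f (a + 1) ((rlMax m π).card + 1) +
       ∑ b ∈ Finset.range (rlMax m π).card, f ((lrMax m π).card + 1) (b + 1)) ≤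
    ∑ σ ∈ baxterFinset (m + 1), f (lrMax (m + 1) σ).card (rlMax (m + 1) σ).card := by
  classical
  let g : (ℕ → ℕ) → ℕ := fun σ => f (lrMax (m + 1) σ).card (rlMax (m + 1) σ).card
  let sites : (ℕ → ℕ) → Finset ℕ := fun π => lrMax m π ∪ (rlMax m π).image (· + 1)
  have h1 : ∀ π ∈ baxterFinset m,
      (∑ a ∈ Finset.range (lrMax m π).card, f (a + 1) ((rlMax m π).card + 1) +
       ∑ b ∈ Finset.range (rlMax m π).card, f ((lrMax m π).card + 1) (b + 1)) =
      ∑ s ∈ sites π, g (insertMax m π s) := by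
    intro π hπ
    rw [mem_baxterFinset] at hπ
    rw [Finset.sum_union, Finset.sum_image (by simp),
      ← sum_card_filter_lt (lrMax m π) (fun a => f (a + 1) ((rlMax m π).card + 1)),
      ← sum_card_filter_gt (rlMax m π) (fun b => f ((lrMax m π).card + 1) (b + 1))]
    · congr 1
      · refine Finset.sum_congr rfl fun s hs => ?_
        simp only [g]
        rw [card_lrMax_insertMax_left hπ hs, card_rlMax_insertMax_left hπ hs]
      · refine Finset.sum_congr rfl fun s hs => ?_
        simp only [g]
        rw [card_lrMax_insertMax_right hπ hs, card_rlMax_insertMax_right hπ hs]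
    · rw [Finset.disjoint_left]
      intro s hs hs'
      obtain ⟨t, ht, rfl⟩ := Finset.mem_image.1 hs'
      have := le_of_mem_lrMax_of_mem_rlMax hπ hs ht
      omega
  rw [Finset.sum_congr rfl h1, Finset.sum_sigma', ← Finset.sum_image
    (f := g) (g := fun x : (_ : ℕ → ℕ) × ℕ => insertMax m x.1 x.2)]
  · refine Finset.sum_le_sum_of_subset fun σ hσ => ?_
    obtain ⟨⟨π, s⟩, hx, rfl⟩ := Finset.mem_image.1 hσ
    simp only [sites, Finset.mem_sigma, mem_baxterFinset, Finset.mem_union,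
      Finset.mem_image] at hx
    rw [mem_baxterFinset]
    exact insertMax_mem_baxterSet hx.1 (by grind)
  · rintro ⟨π, s⟩ hx ⟨π', s'⟩ hx' h
    simp only [Finset.coe_sigma, Set.mem_sigma_iff, Finset.mem_coe, mem_baxterFinset] at hx hx'
    obtain ⟨rfl, rfl⟩ := insertMax_injective hx'.1 h
    rfl

theorem sum_treeCount_le_card (n m : ℕ) :
    ∑ π ∈ baxterFinset m, treeCount n (lrMax m π).card (rlMax m π).card ≤
      (baxterFinset (m + n)).card := by
  induction n generalizing m with
  | zero => simp [treeCount]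
  | succ n ih =>
    rw [show m + (n + 1) = m + 1 + n by ring]
    exact (sum_children_le m (treeCount n)).trans (ih (m + 1))

theorem card_baxterFinset_le_succ {m : ℕ} (hm : 1 ≤ m) :
    (baxterFinset m).card ≤ (baxterFinset (m + 1)).card := by
  refine le_trans ?_ (sum_treeCount_le_card 1 m)
  rw [Finset.card_eq_sum_ones]
  refine Finset.sum_le_sum fun π _ => ?_
  have : 0 < (lrMax m π).card :=
    Finset.card_pos.2 ⟨1, mem_lrMax.2 ⟨⟨le_rfl, hm⟩, fun t _ _ => by omega⟩⟩
  simp only [treeCount, Finset.sum_const, Finset.card_range, smul_eq_mul]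
  omega

theorem treeCount_le_card_baxterFinset (n : ℕ) :
    treeCount n 1 1 ≤ (baxterFinset (n + 1)).card := by
  let ι : ℕ → ℕ := fun i => if i = 1 then 1 else 0
  have hι : ι ∈ baxterFinset 1 := by
    rw [mem_baxterFinset]
    refine ⟨⟨?_, ?_, ?_⟩, ?_⟩
    · simp [Set.BijOn, ι]
    · rintro ⟨p, q, r, h⟩; omega
    · rintro ⟨p, q, r, h⟩; omega
    · intro i hi
      simp only [ι]
      rw [if_neg (by omega)]
  have h1 : lrMax 1 ι = {1} := by
    ext s; rw [mem_lrMax, Finset.mem_singleton]; grind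
  have h2 : rlMax 1 ι = {1} := by
    ext s; rw [mem_rlMax, Finset.mem_singleton]; grind
  have h := (Finset.single_le_sum
    (f := fun π => treeCount n (lrMax 1 π).card (rlMax 1 π).card)
    (fun _ _ => Nat.zero_le _) hι).trans (sum_treeCount_le_card n 1)
  simpa [h1, h2, add_comm] using h

theorem pow_le_card_baxterFinset {m : ℕ} (hm : 1 ≤ m) :
    8 ^ m ≤ 64 * m ^ 6 * (baxterFinset m).card := by
  have odd_bound (p : ℕ) :
      8 ^ (2 * p + 1) ≤ 8 * (2 * p + 1) ^ 6 * (baxterFinset (2 * p + 1)).card :=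
    (pow_le_treeCount p).trans (Nat.mul_le_mul_left _ (treeCount_le_card_baxterFinset _))
  rcases Nat.even_or_odd' m with ⟨p, rfl | rfl⟩
  · obtain ⟨q, rfl⟩ : ∃ q, p = q + 1 := ⟨p - 1, by omega⟩
    have h1 := odd_bound q
    have h2 := card_baxterFinset_le_succ (m := 2 * q + 1) (by omega)
    rw [show 2 * (q + 1) = 2 * q + 1 + 1 by ring]
    calc 8 ^ (2 * q + 1 + 1) = 8 * 8 ^ (2 * q + 1) := by ring
      _ ≤ 8 * (8 * (2 * q + 1) ^ 6 * (baxterFinset (2 * q + 1)).card) := by gcongr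
      _ = 64 * (2 * q + 1) ^ 6 * (baxterFinset (2 * q + 1)).card := by ring
      _ ≤ _ := by gcongr; omega
  · refine (odd_bound p).trans ?_
    gcongr
    norm_num

/-! ### Arrays with repeated entries -/

/-- The number of positions in `{1,…,i}` outside `K`. -/
def freeRank (K : Finset ℕ) (i : ℕ) : ℕ := ((Finset.Icc 1 i).filter (fun t => t ∉ K)).card

theorem freeRank_succ (K : Finset ℕ) (i : ℕ) :
    freeRank K (i + 1) = freeRank K i + if i + 1 ∈ K then 0 else 1 := by
  have h : Finset.Icc 1 (i + 1) = insert (i + 1) (Finset.Icc 1 i) :=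
    (Finset.insert_Icc_right_eq_Icc_add_one (by omega)).symm
  rw [freeRank, h, Finset.filter_insert]
  by_cases h1 : i + 1 ∈ K
  · simp [h1, freeRank]
  · rw [if_pos h1, if_neg h1, Finset.card_insert_of_notMem (by simp)]; rfl

theorem freeRank_mono (K : Finset ℕ) : Monotone (freeRank K) :=
  monotone_nat_of_le_succ fun i => by rw [freeRank_succ]; omega

theorem freeRank_one {K : Finset ℕ} {n : ℕ} (hK : K ⊆ Finset.Icc 2 n) : freeRank K 1 = 1 := by
  have : 1 ∉ K := fun h => by have := Finset.mem_Icc.1 (hK h); omega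
  simp [freeRank, Finset.filter_singleton, this]

theorem freeRank_self {K : Finset ℕ} {n : ℕ} (hK : K ⊆ Finset.Icc 2 n) :
    freeRank K n = n - K.card := by
  have hK' : K ⊆ Finset.Icc 1 n := hK.trans (Finset.Icc_subset_Icc_left (by omega))
  rw [freeRank, Finset.filter_notMem_eq_sdiff, Finset.card_sdiff_of_subset hK', Nat.card_Icc]
  omega

theorem exists_freeRank_eq (K : Finset ℕ) (n r : ℕ) (hr : r ≤ freeRank K n) :
    ∃ i ≤ n, freeRank K i = r := by
  induction n with
  | zero => exact ⟨0, le_rfl, by simp [freeRank] at hr ⊢; omega⟩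
  | succ n ih =>
    by_cases h : r ≤ freeRank K n
    · obtain ⟨i, hi, h'⟩ := ih h
      exact ⟨i, by omega, h'⟩
    · refine ⟨n + 1, le_rfl, ?_⟩
      rw [freeRank_succ] at hr ⊢
      split_ifs at hr ⊢ <;> omega

/-- The array of size `n` in which the positions in `K` repeat their left neighbour and the others
carry `π`. -/
def spread (n : ℕ) (K : Finset ℕ) (π : ℕ → ℕ) (i : ℕ) : ℕ :=
  if 1 ≤ i ∧ i ≤ n then π (freeRank K i) else 0

theorem spread_mem_famA {n : ℕ} {K : Finset ℕ} {π : ℕ → ℕ} (hK : K ⊆ Finset.Icc 2 n)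
    (hπ : π ∈ baxterSet (n - K.card)) : spread n K π ∈ famA n := by
  refine ⟨⟨K, hK, π, hπ.1, fun i h1 h2 h3 => ?_, fun i h1 h2 _ => ?_⟩, fun i hi => ?_⟩
  · obtain ⟨j, rfl⟩ : ∃ j, i = j + 1 := ⟨i - 1, by omega⟩
    simp only [spread, Nat.add_sub_cancel]
    rw [if_pos (by omega), if_pos (by omega), freeRank_succ, if_pos h3, add_zero]
  · simp only [spread]
    rw [if_pos ⟨h1, h2⟩]; rfl
  · simp only [spread]
    rw [if_neg (by omega)]

theorem mem_iff_spread_eq {n i : ℕ} {K : Finset ℕ} {π : ℕ → ℕ} (hK : K ⊆ Finset.Icc 2 n)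
    (hπ : π ∈ baxterSet (n - K.card)) (h1 : 1 ≤ i) (h2 : i + 1 ≤ n) :
    i + 1 ∈ K ↔ spread n K π (i + 1) = spread n K π i := by
  simp only [spread]
  rw [if_pos (by omega), if_pos (by omega), freeRank_succ]
  split_ifs with h
  · simp [h]
  · simp only [h, false_iff]
    intro h'
    have ha : 1 ≤ freeRank K i := (freeRank_one hK).symm.le.trans (freeRank_mono K h1)
    have hb : freeRank K (i + 1) ≤ n - K.card :=
      (freeRank_mono K h2).trans (freeRank_self hK).le
    rw [freeRank_succ, if_neg h] at hb
    have := hπ.1.1.injOn (show freeRank K i + 1 ∈ Set.Icc 1 (n - K.card) from ⟨by omega, hb⟩)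
      (show freeRank K i ∈ Set.Icc 1 (n - K.card) from ⟨ha, by omega⟩) h'
    omega

theorem spread_injective {n : ℕ} {K K' : Finset ℕ} {π π' : ℕ → ℕ} (hK : K ⊆ Finset.Icc 2 n)
    (hK' : K' ⊆ Finset.Icc 2 n) (hπ : π ∈ baxterSet (n - K.card))
    (hπ' : π' ∈ baxterSet (n - K'.card)) (h : spread n K π = spread n K' π') :
    K = K' ∧ π = π' := by
  have hKK : K = K' := by
    ext i
    by_cases hi : 2 ≤ i ∧ i ≤ n
    · obtain ⟨j, rfl⟩ : ∃ j, i = j + 1 := ⟨i - 1, by omega⟩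
      rw [mem_iff_spread_eq hK hπ (by omega) hi.2, h,
        ← mem_iff_spread_eq hK' hπ' (by omega) hi.2]
    · exact iff_of_false (fun h => hi (Finset.mem_Icc.1 (hK h)))
        (fun h => hi (Finset.mem_Icc.1 (hK' h)))
  subst hKK
  refine ⟨rfl, funext fun r => ?_⟩
  by_cases hr : r = 0 ∨ n - K.card < r
  · rw [hπ.2 r hr, hπ'.2 r hr]
  · obtain ⟨i, hi, rfl⟩ := exists_freeRank_eq K n r (by rw [freeRank_self hK]; omega)
    have hi0 : i ≠ 0 := by rintro rfl; simp [freeRank] at hr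
    have := congrFun h i
    simpa [spread, hi, Nat.one_le_iff_ne_zero.2 hi0] using this

theorem famA_finite (n : ℕ) : (famA n).Finite := by
  refine (finite_setOf_bounded n).subset ?_
  rintro A ⟨⟨K, hK, π, hπ, h1, h2⟩, h0⟩
  refine ⟨h0, fun i => ?_⟩
  induction i with
  | zero => simp [h0 0 (Or.inl rfl)]
  | succ i ih =>
    by_cases hi : n < i + 1
    · simp [h0 _ (Or.inr hi)]
    by_cases hiK : i + 1 ∈ K
    · rw [h1 (i + 1) (Finset.mem_Icc.1 (hK hiK)).1 (by omega) hiK]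
      exact ih
    · have hr : freeRank K (i + 1) ∈ Set.Icc 1 (n - K.card) :=
        ⟨(freeRank_one hK).symm.le.trans (freeRank_mono K (by omega)),
          (freeRank_mono K (by omega)).trans (freeRank_self hK).le⟩
      rw [h2 (i + 1) (by omega) (by omega) hiK]
      exact (hπ.1.mapsTo hr).2.trans (Nat.sub_le _ _)

theorem sum_card_baxterFinset_le (n : ℕ) :
    ∑ K ∈ (Finset.Icc 2 n).powerset, (baxterFinset (n - K.card)).card ≤ Nat.card (famA n) := by
  rw [← Finset.card_sigma, Nat.card_coe_set_eq, Set.ncard_eq_toFinset_card _ (famA_finite n)]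
  refine Finset.card_le_card_of_injOn (fun x => spread n x.1 x.2) ?_ ?_
  · rintro ⟨K, π⟩ hx
    simp only [Finset.coe_sigma, Set.mem_sigma_iff, Finset.mem_coe, mem_baxterFinset,
      Finset.mem_powerset] at hx
    simpa using spread_mem_famA hx.1 hx.2
  · rintro ⟨K, π⟩ hx ⟨K', π'⟩ hx' h
    simp only [Finset.coe_sigma, Set.mem_sigma_iff, Finset.mem_coe, mem_baxterFinset,
      Finset.mem_powerset] at hx hx'
    obtain ⟨rfl, rfl⟩ := spread_injective hx.1 hx'.1 hx.2 hx'.2 h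
    rfl

theorem pow_le_card_famA {n : ℕ} (hn : 1 ≤ n) : 9 ^ n ≤ 72 * n ^ 6 * Nat.card (famA n) := by
  have hc : (Finset.Icc 2 n).card = n - 1 := by rw [Nat.card_Icc]; omega
  have h : 8 * 9 ^ (n - 1) ≤ 64 * n ^ 6 * Nat.card (famA n) := by
    calc 8 * 9 ^ (n - 1)
        = ∑ K ∈ (Finset.Icc 2 n).powerset, 8 * (1 ^ K.card * 8 ^ ((n - 1) - K.card)) := by
          rw [← Finset.mul_sum, ← hc, Finset.sum_pow_mul_eq_add_pow]
      _ ≤ ∑ K ∈ (Finset.Icc 2 n).powerset,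
            64 * n ^ 6 * (baxterFinset (n - K.card)).card := by
          refine Finset.sum_le_sum fun K hK => ?_
          have h1 := Finset.card_le_card (Finset.mem_powerset.1 hK)
          rw [hc] at h1
          rw [one_pow, one_mul, ← pow_succ', show n - 1 - K.card + 1 = n - K.card by omega]
          refine (pow_le_card_baxterFinset (by omega)).trans ?_
          gcongr
          omega
      _ ≤ _ := by
          rw [← Finset.mul_sum]
          exact Nat.mul_le_mul_left _ (sum_card_baxterFinset_le n)
  have h9 : 9 ^ n = 9 * 9 ^ (n - 1) := by rw [← pow_succ', Nat.sub_add_cancel hn]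
  rw [h9]
  nlinarith

theorem logb_two_nine_ge : (3.16 : ℝ) ≤ Real.logb 2 9 := by
  rw [Real.le_logb_iff_rpow_le (by norm_num) (by norm_num)]
  have h : ((2 : ℝ) ^ (3.16 : ℝ)) ^ 25 ≤ 9 ^ 25 := by
    rw [← Real.rpow_natCast, ← Real.rpow_mul (by norm_num),
      show (3.16 : ℝ) * (25 : ℕ) = (79 : ℕ) by norm_num, Real.rpow_natCast]
    norm_num
  exact le_of_pow_le_pow_left₀ (by norm_num) (by norm_num) h

theorem stmt9 :
    ∃ c > (0 : ℝ), ∀ n : ℕ, 2 ≤ n →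
      3.16 * (n : ℝ) - c * Real.log n ≤ (n : ℝ) * Real.logb 2 9 - c * Real.log n ∧
      (n : ℝ) * Real.logb 2 9 - c * Real.log n ≤ Real.logb 2 (Nat.card (famA n)) := by
  have hlog2 : 0 < Real.log 2 := Real.log_pos (by norm_num)
  refine ⟨13 / Real.log 2, by positivity, fun n hn => ⟨?_, ?_⟩⟩
  · have := mul_le_mul_of_nonneg_left logb_two_nine_ge (Nat.cast_nonneg (α := ℝ) n)
    linarith
  · have h1 : 9 ^ n ≤ n ^ 13 * Nat.card (famA n) := by
      refine (pow_le_card_famA (by omega : 1 ≤ n)).trans (Nat.mul_le_mul_right _ ?_)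
      have : 2 ^ 7 ≤ n ^ 7 := Nat.pow_le_pow_left hn 7
      calc 72 * n ^ 6 ≤ n ^ 7 * n ^ 6 := Nat.mul_le_mul_right _ (by omega)
        _ = n ^ 13 := by ring
    have hpos : 0 < Nat.card (famA n) := by
      refine Nat.pos_of_ne_zero fun h => ?_
      rw [h, mul_zero] at h1
      have : 0 < 9 ^ n := by positivity
      omega
    have h2 : ((9 : ℝ)) ^ n ≤ (n : ℝ) ^ 13 * (Nat.card (famA n) : ℝ) := by exact_mod_cast h1
    have hn0 : (0 : ℝ) < n := by positivity
    have hpos' : (0 : ℝ) < Nat.card (famA n) := by exact_mod_cast hpos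
    have h3 := Real.logb_le_logb_of_le (b := 2) (by norm_num) (by positivity) h2
    rw [Real.logb_mul (by positivity) (by positivity), Real.logb_pow, Real.logb_pow] at h3
    have h4 : 13 / Real.log 2 * Real.log n = 13 * Real.logb 2 n := by
      rw [Real.logb]; ring
    rw [h4]
    push_cast at h3
    linarith
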